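/- For all integers p ≥ 1 and q ≥ 3, the Cartesian product of signed graphs UC_q □ BC_{2p+1} satisfies χ_s(UC_q □ BC_{2p+1}) > 4, where UC_q is an unbalanced signed cycle of length q and BC_{2p+1} is a balanced signed cycle of length 2p+1. -/

import Mathlib

open SimpleGraph

/-- Two signatures on a graph `G` are equivalent (`σ₂` is obtained from `σ₁` by
switching the set of vertices `{v | s v = true}`); signs are encoded by `Bool`,
with `true` meaning negative, so that the product of signs is `xor`. -/
def SigEquiv {V : Type*} (G : SimpleGraph V) (σ₁ σ₂ : V → V → Bool) : Prop :=
  ∃ s : V → Bool, ∀ u v, G.Adj u v → σ₂ u v = xor (σ₁ u v) (xor (s u) (s v))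

/-- A homomorphism of signed graphs `(G, σ) → (H, π)`: a graph homomorphism
mapping some switching-equivalent signature of `σ` to `π`. -/
def SHom {V W : Type*} (G : SimpleGraph V) (σ : V → V → Bool)
    (H : SimpleGraph W) (π : W → W → Bool) : Prop :=
  ∃ (φ : G →g H) (σ' : V → V → Bool),
    SigEquiv G σ σ' ∧ ∀ u v, G.Adj u v → π (φ u) (φ v) = σ' u v

/-- The chromatic number of a signed graph: the least number of vertices of a
signed graph to which it admits a homomorphism of signed graphs. -/
noncomputable def sChrom {V : Type*} (G : SimpleGraph V) (σ : V → V → Bool) : ℕ :=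
  sInf {n : ℕ | ∃ (H : SimpleGraph (Fin n)) (π : Fin n → Fin n → Bool), SHom G σ H π}

/-- The signature of the Cartesian (box) product of two signed graphs:
a copy of an edge of `H` inside a `G`-fiber keeps its sign, and vice versa. -/
def prodSign {V W : Type*} [DecidableEq V] (σ : V → V → Bool) (π : W → W → Bool)
    (p q : V × W) : Bool :=
  if p.1 = q.1 then π p.2 q.2 else σ p.1 q.1

/-- The successor of a vertex of the cycle on `Fin n`. -/
def cycleSucc {n : ℕ} (i : Fin n) : Fin n :=
  ⟨(i.val + 1) % n, Nat.mod_lt _ (Nat.lt_of_le_of_lt (Nat.zero_le _) i.isLt)⟩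

/-- A signature on the cycle of length `n` is balanced when the number of
negative edges is even, i.e. the product of the signs of its edges is `+1`. -/
def BalancedCycleSign (n : ℕ) (σ : Fin n → Fin n → Bool) : Prop :=
  (Finset.univ.filter (fun i : Fin n => σ i (cycleSucc i) = true)).card % 2 = 0

/-- Fundamental theorem for the cup product on a discrete torus: the sum over the unit squares
of the cup product of two periodic closed `1`-cochains is determined by their periods. -/
theorem sum_cup_eq_periods {R : Type*} [CommRing R] {q m : ℕ} {h v h' v' : ℕ → ℕ → R}
    (hv : ∀ i j, h i j + v (i + 1) j = v i j + h i (j + 1))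
    (hv' : ∀ i j, h' i j + v' (i + 1) j = v' i j + h' i (j + 1))
    (per_h : ∀ i, h i m = h i 0) (per_v : ∀ j, v q j = v 0 j)
    (per_h' : ∀ i, h' i m = h' i 0) (per_v' : ∀ j, v' q j = v' 0 j) :
    ∑ i ∈ Finset.range q, ∑ j ∈ Finset.range m,
        (h i j * v' (i + 1) j - v i j * h' i (j + 1)) =
      (∑ i ∈ Finset.range q, h i 0) * (∑ j ∈ Finset.range m, v' 0 j) -
        (∑ j ∈ Finset.range m, v 0 j) * (∑ i ∈ Finset.range q, h' i 0) := by
  set F : ℕ → ℕ → R := fun i j =>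
    ∑ k ∈ Finset.range i, h k 0 + ∑ l ∈ Finset.range j, v i l with hF
  have F_up : ∀ i j, F i (j + 1) = F i j + v i j := fun i j => by
    simp only [hF, Finset.sum_range_succ]; ring
  have F_right : ∀ i j, F (i + 1) j = F i j + h i j := by
    intro i j
    induction j with
    | zero => simp [hF, Finset.sum_range_succ]
    | succ j ih => rw [F_up, F_up, ih]; linear_combination hv i j
  have F_top : ∀ i, F i m = F i 0 + ∑ j ∈ Finset.range m, v 0 j := by
    intro i
    induction i with
    | zero => simp [hF]
    | succ i ih => rw [F_right, F_right, ih, per_h]; ring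
  have F_end : ∀ j, F q j = F 0 j + ∑ i ∈ Finset.range q, h i 0 := fun j => by
    simp only [hF, per_v]; simp; ring
  have leibniz : ∀ i j, h i j * v' (i + 1) j - v i j * h' i (j + 1) =
      (F (i + 1) j * v' (i + 1) j - F i j * v' i j) -
        (F i (j + 1) * h' i (j + 1) - F i j * h' i j) := fun i j => by
    rw [F_up, F_right]; linear_combination -F i j * hv' i j
  have e1 : ∀ i, ∑ j ∈ Finset.range m, (F i (j + 1) * h' i (j + 1) - F i j * h' i j) =
      (∑ j ∈ Finset.range m, v 0 j) * h' i 0 := fun i => by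
    rw [Finset.sum_range_sub (fun j => F i j * h' i j), F_top, per_h']; ring
  have e2 : ∑ i ∈ Finset.range q, ∑ j ∈ Finset.range m,
      (F (i + 1) j * v' (i + 1) j - F i j * v' i j) =
      ∑ j ∈ Finset.range m, (∑ i ∈ Finset.range q, h i 0) * v' 0 j := by
    rw [Finset.sum_comm]
    refine Finset.sum_congr rfl fun j _ => ?_
    rw [Finset.sum_range_sub (fun i => F i j * v' i j), F_end, per_v']; ring
  simp_rw [leibniz, Finset.sum_sub_distrib (f := fun j => F (_ + 1) j * v' _ j - _)]
  rw [Finset.sum_sub_distrib, e2]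
  simp only [e1, Finset.mul_sum]

/-- A signature of `K₄`, with values in `ZMod 2`, in which all edges at the vertex `0` are
positive. -/
def normalizedSignature (a b c : ZMod 2) : Fin 4 → Fin 4 → ZMod 2 :=
  ![![0, 0, 0, 0], ![0, 0, a, b], ![0, a, 0, c], ![0, b, c, 0]]

set_option synthInstance.maxSize 1000 in
theorem exists_switching_normalizedSignature : ∀ a b c : ZMod 2, ∃ s t : Fin 4 → ZMod 2,
    ∀ x y z w : Fin 4, x ≠ y → y ≠ z → z ≠ w → w ≠ x →
      normalizedSignature a b c x y + normalizedSignature a b c y z +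
        normalizedSignature a b c z w + normalizedSignature a b c w x = 0 →
      (normalizedSignature a b c x y + s x + s y) *
        (1 + normalizedSignature a b c y z + t y + t z) = 0 := by
  have two : ∀ a : ZMod 2, a = 0 ∨ a = 1 := by decide
  intro a b c
  rcases two a with rfl | rfl <;> rcases two b with rfl | rfl <;> rcases two c with rfl | rfl
  · exact ⟨0, 0, by decide⟩
  · exact ⟨0, ![0, 0, 1, 1], by decide⟩
  · exact ⟨0, ![0, 1, 0, 1], by decide⟩
  · exact ⟨![0, 0, 0, 1], ![1, 0, 0, 0], by decide⟩
  · exact ⟨0, ![0, 1, 1, 0], by decide⟩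
  · exact ⟨![0, 0, 1, 0], ![1, 0, 0, 0], by decide⟩
  · exact ⟨![0, 1, 0, 0], ![1, 0, 0, 0], by decide⟩
  · exact ⟨0, ![1, 0, 0, 0], by decide⟩

/-- Every signature `P` of `K₄` and its negation can be switched so that no balanced closed walk
of length `4` has two consecutive edges, the first negative in the former and the second
negative in the latter. -/
theorem exists_switching_of_symm (P : Fin 4 → Fin 4 → ZMod 2) (hP : ∀ x y, P x y = P y x) :
    ∃ s t : Fin 4 → ZMod 2, ∀ x y z w : Fin 4, x ≠ y → y ≠ z → z ≠ w → w ≠ x →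
      P x y + P y z + P z w + P w x = 0 →
      (P x y + s x + s y) * (1 + P y z + t y + t z) = 0 := by
  set r : Fin 4 → ZMod 2 := ![0, P 0 1, P 0 2, P 0 3] with hr
  obtain ⟨s, t, h⟩ := exists_switching_normalizedSignature
    (P 1 2 + P 0 1 + P 0 2) (P 1 3 + P 0 1 + P 0 3) (P 2 3 + P 0 2 + P 0 3)
  set N := normalizedSignature
    (P 1 2 + P 0 1 + P 0 2) (P 1 3 + P 0 1 + P 0 3) (P 2 3 + P 0 2 + P 0 3) with hN
  have key : ∀ x y, x ≠ y → N x y = P x y + r x + r y := by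
    have e1 := hP 1 0
    have e2 := hP 2 0
    have e3 := hP 3 0
    have e4 := hP 2 1
    have e5 := hP 3 1
    have e6 := hP 3 2
    intro x y hxy
    fin_cases x <;> fin_cases y <;>
      simp [hN, hr, normalizedSignature, e1, e2, e3, e4, e5, e6, CharTwo.add_self_eq_zero] at hxy ⊢
    all_goals ring
  have dbl : (2 : ZMod 2) = 0 := by decide
  refine ⟨r + s, r + t, fun x y z w hxy hyz hzw hwx hsum => ?_⟩
  have := h x y z w hxy hyz hzw hwx (by
    rw [key x y hxy, key y z hyz, key z w hzw, key w x hwx]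
    linear_combination hsum + (r x + r y + r z + r w) * dbl)
  rw [key x y hxy, key y z hyz] at this
  rw [← this, Pi.add_apply, Pi.add_apply, Pi.add_apply, Pi.add_apply]
  ring

/-- No proper `4`-colouring of a periodic grid whose vertical period `m` is odd pulls back a
signature of `K₄` to one with balanced squares, balanced vertical cycles and unbalanced
horizontal cycles. -/
theorem false_of_periodic_coloring {q m : ℕ} (hm : Odd m) (c : ℕ → ℕ → Fin 4)
    (P : Fin 4 → Fin 4 → ZMod 2) (hP : ∀ x y, P x y = P y x)
    (per_left : ∀ i j, c (i + q) j = c i j) (per_right : ∀ i j, c i (j + m) = c i j)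
    (ne_left : ∀ i j, c i j ≠ c (i + 1) j) (ne_right : ∀ i j, c i j ≠ c i (j + 1))
    (square : ∀ i j, P (c i j) (c (i + 1) j) + P (c (i + 1) j) (c (i + 1) (j + 1)) =
      P (c i j) (c i (j + 1)) + P (c i (j + 1)) (c (i + 1) (j + 1)))
    (sum_left : ∑ i ∈ Finset.range q, P (c i 0) (c (i + 1) 0) = 1)
    (sum_right : ∑ j ∈ Finset.range m, P (c 0 j) (c 0 (j + 1)) = 0) : False := by
  obtain ⟨s, t, hst⟩ := exists_switching_of_symm P hP
  have dbl : (2 : ZMod 2) = 0 := by decide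
  have top : ∀ i, c i m = c i 0 := fun i => by simpa using per_right i 0
  have top' : ∀ i, c i (m + 1) = c i 1 := fun i => by
    simpa [add_comm] using per_right i 1
  have last : ∀ j, c q j = c 0 j := fun j => by simpa using per_left 0 j
  have last' : ∀ j, c (q + 1) j = c 1 j := fun j => by
    simpa [add_comm] using per_left 1 j
  have switch : ∀ (u : Fin 4 → ZMod 2) (d : ℕ → Fin 4) (n : ℕ), d n = d 0 →
      ∑ i ∈ Finset.range n, (u (d i) + u (d (i + 1))) = 0 := by
    intro u d n hn
    have := Finset.sum_range_sub (fun i => u (d i)) n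
    simp only [hn, sub_self, CharTwo.sub_eq_add] at this
    rw [← this]
    exact Finset.sum_congr rfl fun i _ => add_comm _ _
  have cup := sum_cup_eq_periods (q := q) (m := m)
    (h := fun i j => P (c i j) (c (i + 1) j) + s (c i j) + s (c (i + 1) j))
    (v := fun i j => P (c i j) (c i (j + 1)) + s (c i j) + s (c i (j + 1)))
    (h' := fun i j => 1 + P (c i j) (c (i + 1) j) + t (c i j) + t (c (i + 1) j))
    (v' := fun i j => 1 + P (c i j) (c i (j + 1)) + t (c i j) + t (c i (j + 1)))
    (fun i j => by
      linear_combination square i j + (s (c (i + 1) j) - s (c i (j + 1))) * dbl)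
    (fun i j => by
      linear_combination square i j + (t (c (i + 1) j) - t (c i (j + 1))) * dbl)
    (fun i => by simp only [top]) (fun j => by simp only [last])
    (fun i => by simp only [top]) (fun j => by simp only [last])
  have sq : ∀ i j, P (c i j) (c (i + 1) j) + P (c (i + 1) j) (c (i + 1) (j + 1)) +
      P (c (i + 1) (j + 1)) (c i (j + 1)) + P (c i (j + 1)) (c i j) = 0 := fun i j => by
    rw [hP (c (i + 1) (j + 1)), hP (c i (j + 1)) (c i j)]
    linear_combination square i j +
      (P (c i j) (c i (j + 1)) + P (c i (j + 1)) (c (i + 1) (j + 1))) * dbl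
  rw [Finset.sum_eq_zero fun i _ => Finset.sum_eq_zero fun j _ => ?_] at cup
  · simp only [add_assoc, Finset.sum_add_distrib] at cup
    simp only [← Finset.sum_add_distrib, switch s (c 0) m (top 0),
      switch t (c 0) m (top 0), switch s (fun i => c i 0) q (last 0)] at cup
    simp only [Finset.sum_add_distrib, sum_left, sum_right] at cup
    have hm' : (m : ZMod 2) = 1 := ZMod.natCast_eq_one_iff_odd.mpr hm
    simp [hm'] at cup
  · rw [hst _ _ _ _ (ne_left i j) (ne_right (i + 1) j) (ne_left i (j + 1)).symm
        (ne_right i j).symm (sq i j),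
      hst _ _ _ (c (i + 1) j) (ne_right i j) (ne_left i (j + 1)) (ne_right (i + 1) j).symm
        (ne_left i j).symm, sub_zero]
    rw [← sq i j, hP (c (i + 1) (j + 1)) (c (i + 1) j), hP (c (i + 1) j) (c i j),
      hP (c (i + 1) (j + 1)) (c i (j + 1)), hP (c i (j + 1)) (c i j)]
    ring

/-- The sign of an edge as an element of `ZMod 2`, with `1` meaning negative. -/
def signZMod (b : Bool) : ZMod 2 := if b then 1 else 0

theorem signZMod_xor : ∀ a b, signZMod (xor a b) = signZMod a + signZMod b := by decide

/-- The vertex of the cycle on `Fin n` reached after `i` steps from `0`. -/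
def cycleVertex (n : ℕ) [NeZero n] (i : ℕ) : Fin n := ⟨i % n, Nat.mod_lt _ (NeZero.pos n)⟩

theorem cycleVertex_add_self (n : ℕ) [NeZero n] (i : ℕ) :
    cycleVertex n (i + n) = cycleVertex n i := by
  simp [cycleVertex]

theorem cycleSucc_cycleVertex (n : ℕ) [NeZero n] (i : ℕ) :
    cycleSucc (cycleVertex n i) = cycleVertex n (i + 1) := by
  simp [cycleVertex, cycleSucc]

theorem cycleGraph_adj_cycleVertex (n : ℕ) [NeZero n] (hn : 2 ≤ n) (i : ℕ) :
    (cycleGraph n).Adj (cycleVertex n i) (cycleVertex n (i + 1)) := by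
  rw [cycleGraph_adj']
  right
  obtain ⟨k, rfl⟩ : ∃ k, n = k + 2 := ⟨n - 2, by omega⟩
  have : cycleVertex (k + 2) (i + 1) = cycleVertex (k + 2) i + 1 := by
    ext; simp [cycleVertex, Fin.val_add]
  simp [this]

theorem sum_signZMod_cycle (n : ℕ) [NeZero n] (σ : Fin n → Fin n → Bool) :
    ∑ i ∈ Finset.range n, signZMod (σ (cycleVertex n i) (cycleVertex n (i + 1))) =
      ((Finset.univ.filter (fun i : Fin n => σ i (cycleSucc i) = true)).card : ZMod 2) := by
  rw [Finset.sum_range, Finset.card_filter, Nat.cast_sum]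
  refine Finset.sum_congr rfl fun i _ => ?_
  have : cycleVertex n i = i := by ext; simp [cycleVertex, Nat.mod_eq_of_lt i.isLt]
  rw [← cycleSucc_cycleVertex, this]
  cases h : σ i (cycleSucc i) <;> simp [signZMod]

/-- A finite signed graph maps to its own copy on `Fin n`, so its chromatic number is attained. -/
theorem exists_sHom_sChrom {V : Type*} [Fintype V] (G : SimpleGraph V) (σ : V → V → Bool) :
    ∃ (H : SimpleGraph (Fin (sChrom G σ))) (π : Fin (sChrom G σ) → Fin (sChrom G σ) → Bool),
      SHom G σ H π := by
  refine Nat.sInf_mem (s := {n : ℕ | ∃ (H : SimpleGraph (Fin n)) (π : Fin n → Fin n → Bool),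
    SHom G σ H π}) ?_
  let e := Fintype.equivFin V
  exact ⟨Fintype.card V, G.map e.toEmbedding, fun x y => σ (e.symm x) (e.symm y),
    (SimpleGraph.Embedding.map e.toEmbedding G).toHom, σ, ⟨fun _ => false, by simp⟩,
    fun u v _ => congrArg₂ σ (e.symm_apply_apply u) (e.symm_apply_apply v)⟩

/-- A signed graph whose chromatic number is at most `n` has a proper colouring in `Fin n` such
that the signs, after switching, are read off from a symmetric function of the colours. -/
theorem exists_coloring_of_sChrom_le {V : Type*} [Fintype V] {G : SimpleGraph V}
    {σ : V → V → Bool} (hσ : ∀ u v, G.Adj u v → σ u v = σ v u) {n : ℕ} (hn : sChrom G σ ≤ n) :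
    ∃ (c : V → Fin n) (P : Fin n → Fin n → Bool) (s : V → Bool), (∀ x y, P x y = P y x) ∧
      ∀ u v, G.Adj u v → c u ≠ c v ∧ P (c u) (c v) = xor (σ u v) (xor (s u) (s v)) := by
  classical
  obtain ⟨H, π, φ, σ', ⟨s, hs⟩, hπ⟩ := exists_sHom_sChrom G σ
  have hinj := Fin.castLE_injective hn
  have hsymm : ∀ u v, G.Adj u v → σ' u v = σ' v u := fun u v huv => by
    rw [hs u v huv, hs v u huv.symm, hσ u v huv, Bool.xor_comm (s u)]
  refine ⟨fun u => Fin.castLE hn (φ u), fun x y => decide (∃ u v, G.Adj u v ∧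
    Fin.castLE hn (φ u) = x ∧ Fin.castLE hn (φ v) = y ∧ σ' u v = true), s, ?_, ?_⟩
  · intro x y
    rw [decide_eq_decide]
    constructor <;>
    · rintro ⟨u, v, huv, hu, hv, h⟩
      exact ⟨v, u, huv.symm, hv, hu, hsymm u v huv ▸ h⟩
  · intro u v huv
    refine ⟨fun h => (φ.map_adj huv).ne (hinj h), ?_⟩
    rw [← hs u v huv, Bool.eq_iff_iff, decide_eq_true_iff]
    constructor
    · rintro ⟨u', v', huv', hu, hv, h⟩
      rw [← hπ u v huv, ← hinj hu, ← hinj hv, hπ u' v' huv', h]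
    · exact fun h => ⟨u, v, huv, rfl, rfl, h⟩

/-- The Cartesian product of an unbalanced cycle and a balanced odd cycle has
chromatic number greater than `4`. -/
theorem four_lt_chrom_UC_box_BCodd (p q : ℕ) (hp : 1 ≤ p) (hq : 3 ≤ q)
    (σ₁ : Fin q → Fin q → Bool) (hσ₁ : ∀ u v, σ₁ u v = σ₁ v u)
    (hU : ¬ BalancedCycleSign q σ₁)
    (σ₂ : Fin (2 * p + 1) → Fin (2 * p + 1) → Bool)
    (hσ₂ : ∀ u v, σ₂ u v = σ₂ v u)
    (hBsign : BalancedCycleSign (2 * p + 1) σ₂) :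
    4 < sChrom (cycleGraph q □ cycleGraph (2 * p + 1)) (prodSign σ₁ σ₂) := by
  by_contra! hle
  have : NeZero q := ⟨by omega⟩
  have hodd : Odd (2 * p + 1) := ⟨p, rfl⟩
  have hm : 2 ≤ 2 * p + 1 := by omega
  generalize 2 * p + 1 = m at *
  have : NeZero m := ⟨by omega⟩
  obtain ⟨c, P, s, hP, hc⟩ := exists_coloring_of_sChrom_le
    (fun u v _ => by simp only [prodSign, hσ₁ u.1, hσ₂ u.2, eq_comm (a := u.1)]) hle
  let x : ℕ → ℕ → Fin q × Fin m := fun i j => (cycleVertex q i, cycleVertex m j)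
  have adj_left : ∀ i j, (cycleGraph q □ cycleGraph m).Adj (x i j) (x (i + 1) j) := fun i j =>
    boxProd_adj.mpr (.inl ⟨cycleGraph_adj_cycleVertex q (by omega) i, rfl⟩)
  have adj_right : ∀ i j, (cycleGraph q □ cycleGraph m).Adj (x i j) (x i (j + 1)) := fun i j =>
    boxProd_adj.mpr (.inr ⟨cycleGraph_adj_cycleVertex m hm j, rfl⟩)
  have x_left : ∀ i j, x (i + q) j = x i j := fun i j => by
    simp only [x, cycleVertex_add_self]
  have x_right : ∀ i j, x i (j + m) = x i j := fun i j => by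
    simp only [x, cycleVertex_add_self]
  let S : ℕ → ℕ → ZMod 2 := fun i j => signZMod (s (x i j))
  have sign_left : ∀ i j, signZMod (P (c (x i j)) (c (x (i + 1) j))) =
      signZMod (σ₁ (cycleVertex q i) (cycleVertex q (i + 1))) + (S (i + 1) j - S i j) :=
    fun i j => by
      rw [(hc _ _ (adj_left i j)).2, signZMod_xor, signZMod_xor, prodSign,
        if_neg (cycleGraph_adj_cycleVertex q (by omega) i).ne, CharTwo.sub_eq_add,
        add_comm (S (i + 1) j)]
  have sign_right : ∀ i j, signZMod (P (c (x i j)) (c (x i (j + 1)))) =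
      signZMod (σ₂ (cycleVertex m j) (cycleVertex m (j + 1))) + (S i (j + 1) - S i j) :=
    fun i j => by
      rw [(hc _ _ (adj_right i j)).2, signZMod_xor, signZMod_xor, prodSign,
        if_pos rfl, CharTwo.sub_eq_add, add_comm (S i (j + 1))]
  refine false_of_periodic_coloring (q := q) (m := m) hodd (fun i j => c (x i j))
    (fun a b => signZMod (P a b)) (fun a b => by rw [hP]) (fun i j => by rw [x_left])
    (fun i j => by rw [x_right]) (fun i j => (hc _ _ (adj_left i j)).1)
    (fun i j => (hc _ _ (adj_right i j)).1) (fun i j => ?_) ?_ ?_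
  · simp only [sign_left, sign_right]
    ring
  · simp only [sign_left, Finset.sum_add_distrib, sum_signZMod_cycle]
    have hS : S q 0 = S 0 0 := by simpa using congrArg (fun y => signZMod (s y)) (x_left 0 0)
    rw [Finset.sum_range_sub (fun i => S i 0), hS, sub_self, add_zero,
      ZMod.natCast_eq_one_iff_odd, Nat.odd_iff]
    exact Nat.mod_two_ne_zero.mp hU
  · simp only [sign_right, Finset.sum_add_distrib, sum_signZMod_cycle]
    have hS : S 0 m = S 0 0 := by simpa using congrArg (fun y => signZMod (s y)) (x_right 0 0)
    rw [Finset.sum_range_sub (fun j => S 0 j), hS, sub_self, add_zero,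
      ZMod.natCast_eq_zero_iff_even, Nat.even_iff]
    exact hBsign
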